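/- Let d ≥ 3 be an integer, c a nonzero integer, and f(z) = z^d + 1/c ∈ ℚ[z]. If f is irreducible over ℚ, then the second iterate f²(z) = f(f(z)) is irreducible over ℚ. -/

import Mathlib

open Polynomial

/-- Lucas sequence `x^k + y^k` with `x + y = T`, `x y = N`. -/
def lucV (T N : ℤ) : ℕ → ℤ
  | 0 => 2
  | 1 => T
  | (k + 2) => T * lucV T N (k + 1) - N * lucV T N k

/-- Coefficients of `(1 + √t)^k`. -/
def pairAW (t : ℤ) : ℕ → ℤ × ℤ
  | 0 => (1, 0)
  | (k + 1) => ((pairAW t k).1 + t * (pairAW t k).2, (pairAW t k).1 + (pairAW t k).2)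

lemma lucV_eq {R : Type*} [CommRing R] (x y : R) (T N : ℤ) (hT : x + y = T) (hN : x * y = N) :
    ∀ k, x ^ k + y ^ k = (lucV T N k : R) ∧ x ^ (k + 1) + y ^ (k + 1) = (lucV T N (k + 1) : R) := by
  intro k
  induction k with
  | zero => simp [lucV, hT]; norm_num
  | succ k ih =>
    refine ⟨ih.2, ?_⟩
    rw [lucV]
    push_cast
    rw [← ih.1, ← ih.2, ← hT, ← hN]
    ring

lemma lucV_dvd (T N : ℤ) : ∀ k, T ∣ lucV T N (2 * k + 1) := by
  intro k
  induction k with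
  | zero => simp [lucV]
  | succ k ih =>
    rw [show 2 * (k + 1) + 1 = (2 * k + 1) + 2 by ring, lucV]
    exact dvd_sub (dvd_mul_right _ _) (dvd_mul_of_dvd_right ih _)

lemma pairAW_add (t : ℤ) (i j : ℕ) :
    (pairAW t (i + j)).1 = (pairAW t i).1 * (pairAW t j).1 + t * (pairAW t i).2 * (pairAW t j).2 ∧
    (pairAW t (i + j)).2 = (pairAW t i).1 * (pairAW t j).2 + (pairAW t i).2 * (pairAW t j).1 := by
  induction j with
  | zero => simp [pairAW]
  | succ j ih =>
    rw [← add_assoc]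
    simp only [pairAW]
    rw [ih.1, ih.2]
    constructor <;> ring

lemma pairAW_norm (t : ℤ) (k : ℕ) :
    (pairAW t k).1 ^ 2 - t * (pairAW t k).2 ^ 2 = (1 - t) ^ k := by
  induction k with
  | zero => simp [pairAW]
  | succ k ih =>
    simp only [pairAW]
    rw [pow_succ (1 - t), ← ih]; ring

lemma lucV_two (e t : ℤ) (he : e ^ 2 = 1) :
    ∀ k, lucV (2 * e) (1 - t) k = 2 * e ^ k * (pairAW t k).1 ∧
      lucV (2 * e) (1 - t) (k + 1) = 2 * e ^ (k + 1) * (pairAW t (k + 1)).1 := by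
  intro k
  induction k with
  | zero => simp [pairAW, lucV]
  | succ k ih =>
    refine ⟨ih.2, ?_⟩
    rw [lucV, ih.1, ih.2]
    simp only [pairAW]
    rw [pow_succ e (k + 1), pow_succ e k]
    linear_combination (2 * e ^ k * (pairAW t k).1 - 2 * e ^ k * (pairAW t k).1 * t) * he

/-- parity, `t` even -/
lemma pairAW_even (t : ℤ) (ht : Even t) (k : ℕ) :
    Odd (pairAW t k).1 ∧ (Even (pairAW t k).2 ↔ Even k) := by
  induction k with
  | zero => simp [pairAW]
  | succ k ih =>
    obtain ⟨h1, h2⟩ := ih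
    simp only [pairAW]
    constructor
    · exact h1.add_even (ht.mul_right _)
    · rw [Int.even_add, Nat.even_add_one, h2]
      have := Int.not_even_iff_odd.mpr h1
      tauto

lemma pairAW_odd (t : ℤ) (ht : Odd t) (k : ℕ) : Even (pairAW t (k + 2)).1 ∧ Even (pairAW t (k + 2)).2 := by
  induction k with
  | zero =>
    simp only [pairAW]
    obtain ⟨s, rfl⟩ := ht
    constructor
    · exact ⟨s + 1, by ring⟩
    · exact ⟨1, by ring⟩
  | succ k ih =>
    rw [show k + 1 + 2 = (k + 2) + 1 by ring, pairAW]
    exact ⟨ih.1.add (ih.2.mul_left _), ih.1.add ih.2⟩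

lemma pairAW_struct1 (τ : ℤ) (s : ℕ) : ∃ α β : ℤ,
    (pairAW (4 * τ) (2 ^ (s + 1))).1 = 1 + 2 ^ s * (4 * τ) * (2 * α + 1) ∧
    (pairAW (4 * τ) (2 ^ (s + 1))).2 = 2 ^ (s + 1) * (2 * β + 1) := by
  induction s with
  | zero => exact ⟨0, 0, by simp [pairAW], by simp [pairAW]⟩
  | succ s ih =>
    obtain ⟨α, β, h1, h2⟩ := ih
    have := pairAW_add (4 * τ) (2 ^ (s + 1)) (2 ^ (s + 1))
    rw [← two_mul, ← pow_succ'] at this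
    rw [this.1, this.2, h1, h2]
    refine ⟨α + 2 ^ s * τ * (2 * α + 1) ^ 2 + 2 ^ s * (2 * β + 1) ^ 2,
      β + 2 ^ s * (2 * τ) * (2 * α + 1) * (2 * β + 1), ?_, ?_⟩
    · ring
    · ring

lemma pairAW_struct2 (τ : ℤ) (s m : ℕ) : ∃ α β : ℤ,
    (pairAW (4 * τ) (2 ^ (s + 1) * m)).1 = 1 + 2 ^ s * (4 * τ) * (2 * α + m) ∧
    (pairAW (4 * τ) (2 ^ (s + 1) * m)).2 = 2 ^ (s + 1) * (2 * β + m) := by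
  induction m with
  | zero => exact ⟨0, 0, by simp [pairAW], by simp [pairAW]⟩
  | succ m ih =>
    obtain ⟨α, β, h1, h2⟩ := ih
    obtain ⟨α', β', h1', h2'⟩ := pairAW_struct1 τ s
    have := pairAW_add (4 * τ) (2 ^ (s + 1) * m) (2 ^ (s + 1))
    rw [show 2 ^ (s + 1) * m + 2 ^ (s + 1) = 2 ^ (s + 1) * (m + 1) by ring] at this
    rw [this.1, this.2, h1, h2, h1', h2']
    refine ⟨α + α' + 2 ^ s * (2 * τ) * (2 * α + m) * (2 * α' + 1) +
      2 ^ (s + 1) * (2 * β + m) * (2 * β' + 1),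
      β + β' + 2 ^ s * (2 * τ) * ((2 * α + m) * (2 * β' + 1) + (2 * β + m) * (2 * α' + 1)), ?_, ?_⟩
    · push_cast; ring
    · push_cast; ring

lemma pairAW_ne (τ : ℤ) (hτ : τ ≠ 0) (p : ℕ) (hp : Odd p) (hp1 : 1 < p) :
    (pairAW (4 * τ) p).1 ≠ 1 := by
  obtain ⟨q, rfl⟩ := hp
  obtain ⟨s, m, hm, hq⟩ := Nat.exists_eq_two_pow_mul_odd (n := q) (by omega)
  obtain ⟨l, rfl⟩ := hm
  obtain ⟨α, β, h1, h2⟩ := pairAW_struct2 τ s (2 * l + 1)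
  rw [show 2 * q + 1 = 2 ^ (s + 1) * (2 * l + 1) + 1 by rw [hq]; ring, pairAW]
  simp only
  rw [h1, h2]
  intro h
  have : (2 : ℤ) ^ s * (4 * τ) * ((2 * α + ((2 * l + 1 : ℕ) : ℤ)) + 2 * (2 * β + ((2 * l + 1 : ℕ) : ℤ))) = 0 := by
    linear_combination h
  rcases mul_eq_zero.mp this with h | h
  · simp [hτ] at h
  · push_cast at h; omega

lemma pairAW_mod4 (t : ℤ) (k : ℕ) (ht : 4 ∣ t) : 4 ∣ (pairAW t k).1 - 1 := by
  induction k with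
  | zero => simp [pairAW]
  | succ k ih =>
    rw [pairAW]
    obtain ⟨a, ha⟩ := ih
    obtain ⟨b, rfl⟩ := ht
    exact ⟨a + b * (pairAW (4 * b) k).2, by linear_combination ha⟩

/-- case `T = 2e` -/
lemma core_two (e N m : ℤ) (he : e ^ 2 = 1) (p : ℕ) (hp : Odd p) (hp1 : 1 < p)
    (hV : lucV (2 * e) N p = 2) (hN : N ^ p = 1 + m) (hm : 2 ∣ m → 4 ∣ m) : m = 0 := by
  obtain ⟨t, rfl⟩ : ∃ t, N = 1 - t := ⟨1 - N, by ring⟩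
  have hep : e ^ p = e := by
    obtain ⟨q, rfl⟩ := hp
    rw [pow_succ, pow_mul, he]; simp
  rw [(lucV_two e t he p).1, hep] at hV
  have hA : (pairAW t p).1 = e := by
    have h2 : e * (pairAW t p).1 = 1 := by linarith
    linear_combination e * h2 - (pairAW t p).1 * he
  have hn := pairAW_norm t p
  rw [hA, he, hN] at hn
  have hte : Even t := by
    by_contra h
    obtain ⟨k, rfl⟩ : ∃ k, p = k + 2 := ⟨p - 2, by omega⟩
    have := (pairAW_odd t (Int.not_even_iff_odd.mp h) k).1
    rw [hA] at this
    have h2 : Even (e ^ 2) := this.pow_of_ne_zero two_ne_zero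
    rw [he] at h2
    exact absurd h2 (by decide)
  have hW : Odd (pairAW t p).2 := by
    rw [← Int.not_even_iff_odd, (pairAW_even t hte p).2, Nat.not_even_iff_odd]; exact hp
  have h4m : (4 : ℤ) ∣ m := hm (by
    have : m = - (t * (pairAW t p).2 ^ 2) := by linarith
    rw [this]
    exact (dvd_mul_of_dvd_left hte.two_dvd _).neg_right)
  have h4t : (4 : ℤ) ∣ t := by
    have h1 : (4 : ℤ) ∣ t * (pairAW t p).2 ^ 2 := by
      have : t * (pairAW t p).2 ^ 2 = - m := by linarith
      rw [this]; exact h4m.neg_right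
    refine IsCoprime.dvd_of_dvd_mul_right ?_ h1
    have : IsCoprime (2 : ℤ) (pairAW t p).2 := by
      rw [Int.isCoprime_iff_gcd_eq_one]
      obtain ⟨w, hw⟩ := hW
      rw [hw]
      rw [← Int.isCoprime_iff_gcd_eq_one]
      exact ⟨-w, 1, by ring⟩
    simpa using this.pow (m := 2) (n := 2)
  have he1 : e = 1 := by
    have := pairAW_mod4 t p h4t
    rw [hA] at this
    rcases mul_self_eq_one_iff.mp ((sq e).symm.trans he) with h | h
    · exact h
    · rw [h] at this; norm_num at this
  obtain ⟨τ, rfl⟩ := h4t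
  have : τ = 0 := by
    by_contra h
    exact pairAW_ne τ h p hp hp1 (hA.trans he1)
  subst this
  linarith

lemma lucV_mod2 (T N : ℤ) (hT : Odd T) (hN : Odd N) (k : ℕ) :
    Even (lucV T N (3 * k)) ∧ Odd (lucV T N (3 * k + 1)) ∧ Odd (lucV T N (3 * k + 2)) := by
  induction k with
  | zero =>
    refine ⟨by simp [lucV], by simpa [lucV] using hT, ?_⟩
    simp only [lucV]
    exact (hT.mul hT).sub_even (even_two.mul_left _)
  | succ k ih =>
    obtain ⟨h0, h1, h2⟩ := ih
    have h3 : Even (lucV T N (3 * k + 1 + 2)) := by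
      rw [lucV]; exact (hT.mul h2).sub_odd (hN.mul h1)
    have h4 : Odd (lucV T N (3 * k + 2 + 2)) := by
      rw [lucV]; exact (h3.mul_left _).sub_odd (hN.mul h2)
    have h5 : Odd (lucV T N (3 * k + 3 + 2)) := by
      rw [lucV]; exact (hT.mul h4).sub_even (h3.mul_left _)
    exact ⟨h3, h4, h5⟩

lemma lucV_mod2' (T N : ℤ) (hT : Odd T) (hN : Even N) (k : ℕ) : Odd (lucV T N (k + 1)) := by
  induction k with
  | zero => simpa [lucV] using hT
  | succ k ih => rw [lucV]; exact (hT.mul ih).sub_even (hN.mul_right _)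

lemma core (T N m : ℤ) (p : ℕ) (hpp : p.Prime) (hp : Odd p)
    (hV : lucV T N p = 2) (hN : N ^ p = 1 + m) (hm : 2 ∣ m → 4 ∣ m) : m = 0 := by
  have hT : T ∣ 2 := by
    obtain ⟨q, rfl⟩ := hp
    rw [← hV]; exact lucV_dvd T N q
  by_cases hTe : Even T
  · obtain ⟨e, rfl⟩ := hTe.two_dvd
    have : e ∣ 1 := by
      obtain ⟨k, hk⟩ := hT
      exact ⟨k, by linarith⟩
    have he : e ^ 2 = 1 := by
      rcases Int.isUnit_iff.mp (isUnit_of_dvd_one this) with h | h <;> simp [h]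
    exact core_two e N m he p hp hpp.one_lt hV hN hm
  · rw [Int.not_even_iff_odd] at hTe
    have hNo : Odd N := by
      by_contra h
      have := lucV_mod2' T N hTe (Int.not_odd_iff_even.mp h) (p - 1)
      rw [Nat.sub_add_cancel hpp.one_lt.le, hV] at this
      exact absurd this (by decide)
    have hp3 : p = 3 := by
      have h3 : 3 ∣ p := by
        have h := lucV_mod2 T N hTe hNo (p / 3)
        have h2 : ¬ Odd (2 : ℤ) := by decide
        rcases (by omega : p = 3 * (p / 3) ∨ p = 3 * (p / 3) + 1 ∨ p = 3 * (p / 3) + 2) with e | e | e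
        · exact ⟨_, e⟩
        · rw [← e, hV] at h; exact absurd h.2.1 h2
        · rw [← e, hV] at h; exact absurd h.2.2 h2
      exact ((Nat.prime_dvd_prime_iff_eq Nat.prime_three hpp).mp h3).symm
    subst hp3
    have hT1 : T = 1 ∨ T = -1 := by
      have h1 : T ≤ 2 := Int.le_of_dvd (by norm_num) hT
      have h2 : -T ≤ 2 := Int.le_of_dvd (by norm_num) (by simpa using hT)
      obtain ⟨s, rfl⟩ := hTe
      omega
    simp only [lucV] at hV
    rcases hT1 with rfl | rfl
    · omega
    · have : N = 1 := by omega
      subst this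
      linarith

lemma pow_sub_pow_sq (A B s : ℤ) (q : ℕ) (hq : q.Prime) (hodd : Odd q) (hc : IsCoprime A B)
    (h : A ^ q - B ^ q = s ^ 2) (hs : ¬ (q : ℤ) ∣ s) : ∃ a, A - B = a ^ 2 := by
  have hqp : Prime (q : ℤ) := Nat.prime_iff_prime_int.mp hq
  have hs0 : s ≠ 0 := by rintro rfl; simp at hs
  set G := ∑ i ∈ Finset.range q, A ^ i * B ^ (q - 1 - i) with hG
  have hmul : (A - B) * G = s ^ 2 := by
    rw [← h, mul_comm]; exact Commute.geom_sum₂_mul (Commute.all A B) q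
  have hcA : IsCoprime (A - B) A := by
    obtain ⟨u, v, huv⟩ := hc
    exact ⟨-v, u + v, by linear_combination huv⟩
  have hcq : IsCoprime (A - B) (q : ℤ) := by
    rw [isCoprime_comm, hqp.coprime_iff_not_dvd]
    intro hd
    exact hs (hqp.dvd_of_dvd_pow (hmul ▸ Dvd.dvd.mul_right hd G))
  have hGm : (A - B) ∣ G - q * A ^ (q - 1) := by
    have : (q : ℤ) * A ^ (q - 1) = ∑ i ∈ Finset.range q, A ^ i * A ^ (q - 1 - i) := by
      rw [Finset.sum_congr rfl (g := fun _ => A ^ (q - 1))]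
      · simp
      · intro i hi
        rw [← pow_add]
        congr 1
        have := Finset.mem_range.mp hi
        omega
    rw [this, hG, ← Finset.sum_sub_distrib]
    refine Finset.dvd_sum fun i _ => ?_
    rw [← mul_sub]
    refine dvd_mul_of_dvd_right ?_ _
    rw [dvd_sub_comm]
    exact sub_dvd_pow_sub_pow A B _
  have hcG : IsCoprime (A - B) G := by
    obtain ⟨u, hu⟩ := hGm
    have : G = q * A ^ (q - 1) + (A - B) * u := by linarith
    rw [this]
    exact (hcq.mul_right hcA.pow_right).add_mul_left_right u
  have hpos : 0 < A - B := by
    have h2 : B ^ q < A ^ q := by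
      have : 0 < s ^ 2 := by positivity
      linarith
    have := (hodd.strictMono_pow (R := ℤ)).lt_iff_lt.mp h2
    linarith
  obtain ⟨a, ha | ha⟩ := Int.sq_of_isCoprime hcG hmul
  · exact ⟨a, ha⟩
  · nlinarith [sq_nonneg a]

lemma trick2 (k z : ℤ) (q : ℕ) (hq : q.Prime) (hodd : Odd q) (hk : Odd k) (hz : z ≠ 0)
    (h : 4 * (k ^ (2 * q) - 1) = (2 * z) ^ q) (hqk : (q : ℤ) ∣ k ^ (2 * q) - 1) : False := by
  have hq3 : 3 ≤ q := by
    have := hq.two_le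
    obtain ⟨r, hr⟩ := hodd
    omega
  have hqp : Prime (q : ℤ) := Nat.prime_iff_prime_int.mp hq
  have hk0 : k ≠ 0 := by rintro rfl; exact absurd hk (by decide)
  have hk2 : 1 ≤ k ^ 2 := by
    have : 0 < k ^ 2 := by positivity
    linarith
  have hkk : k ^ (2 * q) = (k ^ 2) ^ q := pow_mul _ _ _
  have hz0 : 0 < z := by
    have h1 : 0 ≤ (2 * z) ^ q := by
      rw [← h, hkk]
      have : 1 ≤ (k ^ 2) ^ q := one_le_pow₀ hk2
      linarith
    have := hodd.pow_nonneg_iff.mp h1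
    omega
  have hzk : z < k ^ 2 := by
    by_contra hcon
    push Not at hcon
    have h1 : (k ^ 2) ^ q ≤ z ^ q := pow_le_pow_left₀ (by positivity) hcon q
    have h2 : (2 : ℤ) ^ 3 ≤ 2 ^ q := pow_le_pow_right₀ (by norm_num) hq3
    rw [mul_pow, hkk] at h
    have h3 : (0 : ℤ) < z ^ q := by positivity
    nlinarith
  have hcop : IsCoprime (k ^ 4) (2 * z) := by
    refine IsCoprime.pow_left ?_
    have h4 : IsCoprime k (-4) := by
      obtain ⟨r, rfl⟩ := hk
      exact ⟨2 * r + 1, r ^ 2 + r, by ring⟩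
    rw [← IsCoprime.pow_right_iff (m := q) hq.pos, ← h]
    obtain ⟨m, rfl⟩ : ∃ m, q = m + 1 := ⟨q - 1, by omega⟩
    have : 4 * (k ^ (2 * (m + 1)) - 1) = -4 + k * (4 * k ^ (2 * m + 1)) := by ring
    rw [this]
    exact h4.add_mul_left_right _
  obtain ⟨a, ha⟩ := pow_sub_pow_sq (k ^ 4) (2 * z) (k ^ (2 * q) - 2) q hq hodd hcop (by
    rw [← h]; ring) (by
    intro hd
    have := dvd_sub hqk hd
    rw [show k ^ (2 * q) - 1 - (k ^ (2 * q) - 2) = 1 by ring] at this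
    exact hqp.not_dvd_one this)
  have ha' : |a| ^ 2 = k ^ 4 - 2 * z := by rw [sq_abs, ha]
  have hb := abs_nonneg a
  generalize |a| = b at *
  have h4 : k ^ 4 = (k ^ 2) ^ 2 := by ring
  rw [h4] at ha'
  generalize k ^ 2 = K at *
  have h5 : b < K := by nlinarith
  have h6 : K - 1 ≤ b := by
    by_contra hcon
    have : b ≤ K - 2 := by omega
    nlinarith
  have h7 : b = K - 1 := by omega
  subst h7
  have : 2 * z = 2 * K - 1 := by linarith
  omega

lemma trick1 (k w s : ℤ) (q : ℕ) (hq : q.Prime) (hodd : Odd q) (hk : Odd k) (hk1 : k ^ 2 ≠ 1)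
    (h : k ^ q + 1 = 2 * w ^ q) (hs : k ^ q - 1 = 2 * s) (hqs : ¬ (q : ℤ) ∣ s) : False := by
  have hq3 : 3 ≤ q := by
    have := hq.two_le
    obtain ⟨r, hr⟩ := hodd
    omega
  have hcop : IsCoprime (w ^ 2) k := by
    refine IsCoprime.pow_left ?_
    obtain ⟨m, rfl⟩ : ∃ m, q = m + 1 := ⟨q - 1, by omega⟩
    exact ⟨2 * w ^ m, - k ^ m, by linear_combination - h⟩
  obtain ⟨a, ha⟩ := pow_sub_pow_sq (w ^ 2) k s q hq hodd hcop (by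
    have h1 : w ^ q = s + 1 := by linarith
    have h2 : k ^ q = 2 * s + 1 := by linarith
    rw [← pow_mul, mul_comm, pow_mul, h1, h2]; ring) hqs
  have hK : |k| ^ q ≤ 2 * |w| ^ q + 1 := by
    rw [← abs_pow, ← abs_pow]
    have h2 : k ^ q = 2 * w ^ q - 1 := by linarith
    rw [h2]
    rcases abs_cases (2 * w ^ q - 1) with h | h <;> rcases abs_cases (w ^ q) with h' | h' <;> linarith
  have hK3 : 3 ≤ |k| := by
    obtain ⟨r, rfl⟩ := hk
    have : r ≠ 0 := by rintro rfl; simp at hk1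
    have : r ≠ -1 := by rintro rfl; simp at hk1
    rcases abs_cases (2 * r + 1) with h | h <;> omega
  have hlt : |k| < 2 * |w| - 1 := by
    by_contra hcon
    push Not at hcon
    have hw0 := abs_nonneg w
    rcases le_or_gt |w| 1 with hw | hw
    · have h1 : |w| ^ q ≤ 1 := pow_le_one₀ hw0 hw
      have h2 : (3 : ℤ) ^ q ≤ |k| ^ q := pow_le_pow_left₀ (by norm_num) hK3 q
      have h3 : (3 : ℤ) ^ 3 ≤ 3 ^ q := pow_le_pow_right₀ (by norm_num) hq3
      linarith
    · have h1 : (3 * |w|) ^ q ≤ (2 * |k|) ^ q := pow_le_pow_left₀ (by positivity) (by linarith) q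
      rw [mul_pow, mul_pow] at h1
      have h3 : 3 * (2 : ℤ) ^ q ≤ 3 ^ q := by
        obtain ⟨m, rfl⟩ : ∃ m, q = m + 3 := ⟨q - 3, by omega⟩
        have : (2 : ℤ) ^ m ≤ 3 ^ m := pow_le_pow_left₀ (by norm_num) (by norm_num) m
        rw [pow_add, pow_add]
        have : (0 : ℤ) < 2 ^ m := by positivity
        linarith
      have h4 : 1 < |w| ^ q := one_lt_pow₀ hw (by omega)
      have h5 : (0 : ℤ) < 2 ^ q := by positivity
      have h6 : 2 ^ q * |k| ^ q ≥ 2 ^ q * (3 * |w| ^ q) := by nlinarith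
      have h7 := le_of_mul_le_mul_left h6 h5
      linarith
  have ha2 : |a| ^ 2 = |w| ^ 2 - k := by rw [sq_abs, sq_abs, ha]
  have hb := abs_nonneg a
  have hw0 := abs_nonneg w
  have hk0 : k ≠ 0 := by rintro rfl; simp at hK3
  generalize |a| = b at *
  generalize |w| = v at *
  rcases lt_or_gt_of_ne hk0 with hneg | hpos
  · rw [abs_of_neg hneg] at hlt
    have : v < b := by nlinarith
    nlinarith
  · rw [abs_of_pos hpos] at hlt
    have : b < v := by nlinarith
    nlinarith

lemma special (k z : ℤ) (q : ℕ) (hq : q.Prime) (hodd : Odd q) (hk : Odd k)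
    (h : 4 * (k ^ (2 * q) - 1) = (2 * z) ^ q) : z = 0 := by
  by_contra hz
  have hk1 : k ^ 2 ≠ 1 := by
    intro h1
    rw [pow_mul, h1, one_pow, sub_self, mul_zero] at h
    have := pow_eq_zero_iff (hq.ne_zero) |>.mp h.symm
    omega
  obtain ⟨r, hr⟩ : Odd (k ^ q) := hk.pow
  have hk2 : k ^ (2 * q) = (2 * r + 1) ^ 2 := by rw [← hr, ← pow_mul, mul_comm]
  have h16 : 16 * r * (r + 1) = (2 * z) ^ q := by rw [← h, hk2]; ring
  by_cases hqd : (q : ℤ) ∣ k ^ (2 * q) - 1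
  · exact trick2 k z q hq hodd hk hz h hqd
  · have hq' : ¬ (q : ℤ) ∣ r * (r + 1) := by
      intro hd
      apply hqd
      rw [hk2, show (2 * r + 1) ^ 2 - 1 = r * (r + 1) * 4 by ring]
      exact hd.mul_right _
    rcases Int.even_or_odd r with he | ho
    · have hc : IsCoprime (r + 1) (16 * r) := by
        obtain ⟨t, rfl⟩ := he.two_dvd
        have h2 : IsCoprime (2 * t + 1) (2 : ℤ) := ⟨1, -t, by ring⟩
        have : IsCoprime (2 * t + 1) (2 ^ 4 : ℤ) := h2.pow_right
        exact IsCoprime.mul_right (by simpa using this) ⟨1, -1, by ring⟩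
      obtain ⟨w, hw⟩ := Int.eq_pow_of_mul_eq_pow_odd_left hc hodd (by rw [← h16]; ring)
      exact trick1 k w r q hq hodd hk hk1 (by rw [← hw, hr]; ring) (by rw [hr]; ring)
        (fun hd => hq' (hd.mul_right _))
    · have hc : IsCoprime r (16 * (r + 1)) := by
        obtain ⟨t, rfl⟩ := ho
        have h2 : IsCoprime (2 * t + 1) (2 : ℤ) := ⟨1, -t, by ring⟩
        have : IsCoprime (2 * t + 1) (2 ^ 4 : ℤ) := h2.pow_right
        exact IsCoprime.mul_right (by simpa using this) ⟨-1, 1, by ring⟩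
      obtain ⟨w, hw⟩ := Int.eq_pow_of_mul_eq_pow_odd_left hc hodd (by rw [← h16]; ring)
      exact trick1 (-k) (-w) (-(r + 1)) q hq hodd hk.neg (by simpa using hk1)
        (by rw [hodd.neg_pow, hodd.neg_pow, ← hw, hr]; ring) (by rw [hodd.neg_pow, hr]; ring)
        (fun hd => hq' (((dvd_neg.mp hd) : (q : ℤ) ∣ r + 1).mul_left _))

lemma pow_sub_pow_two (u v : ℤ) (n : ℕ) (hn : Odd n) (hn3 : 3 ≤ n) (h : v ^ n - u ^ n = 2) :
    v ^ n = 1 := by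
  have hn0 : n ≠ 0 := by omega
  have hlt : u < v := (hn.strictMono_pow (R := ℤ)).lt_iff_lt.mp (by linarith)
  have hd : v - u ∣ 2 := h ▸ sub_dvd_pow_sub_pow v u n
  have hle := Int.le_of_dvd (by norm_num) hd
  have hpar : Even (v - u) := by
    have : Even (v ^ n - u ^ n) := by rw [h]; exact even_two
    rw [Int.even_sub, Int.even_pow, Int.even_pow] at this
    rw [Int.even_sub]
    tauto
  obtain ⟨r, hr⟩ := hpar
  have hv : v = u + 2 := by omega
  have h8 : (2 : ℤ) ^ 3 ≤ 2 ^ n := pow_le_pow_right₀ (by norm_num) hn3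
  rcases lt_trichotomy u (-1) with h1 | h1 | h1
  · have := pow_add_pow_le (x := -v) (y := 2) (by omega) (by norm_num) hn0
    rw [show -v + 2 = -u by omega, hn.neg_pow, hn.neg_pow] at this
    linarith
  · rw [hv, h1]; norm_num
  · have := pow_add_pow_le (x := u) (y := 2) (by omega) (by norm_num) hn0
    rw [← hv] at this
    linarith

lemma square_case (T N c : ℤ) (n : ℕ) (hn : Odd n) (hn3 : 3 ≤ n) (hT : T ^ 2 - 2 * N = 2)
    (hN : N ^ 2 = 1 + c ^ n) : c = 0 := by
  have hTe : Even T := by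
    by_contra h
    have := (Int.not_even_iff_odd.mp h).pow (n := 2)
    obtain ⟨r, hr⟩ := this
    omega
  obtain ⟨a, rfl⟩ := hTe.two_dvd
  have hNa : N = 2 * a ^ 2 - 1 := by nlinarith
  subst hNa
  have key : (4 * a ^ 2) * (a ^ 2 - 1) = c ^ n := by linarith
  have hn0 : n ≠ 0 := by omega
  have fin : 4 * a ^ 2 = 0 ∨ a ^ 2 - 1 = 0 → c = 0 := by
    intro h
    rw [← mul_eq_zero, key] at h
    exact (pow_eq_zero_iff hn0).mp h
  rcases Int.even_or_odd a with he | ho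
  · obtain ⟨b, rfl⟩ := he.two_dvd
    have hc : IsCoprime ((2 * b) ^ 2 - 1) (4 * (2 * b) ^ 2) := ⟨-1 - 4 * b ^ 2, b ^ 2, by ring⟩
    obtain ⟨l, hl⟩ := Int.eq_pow_of_mul_eq_pow_odd_left hc hn (by rw [← key]; ring)
    have hc2 : IsCoprime (2 * b - 1) (2 * b + 1) := ⟨b, 1 - b, by ring⟩
    obtain ⟨⟨u, hu⟩, ⟨v, hv⟩⟩ := Int.eq_pow_of_mul_eq_pow_odd hc2 hn
      (show (2 * b - 1) * (2 * b + 1) = l ^ n by rw [← hl]; ring)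
    have := pow_sub_pow_two u v n hn hn3 (by rw [← hu, ← hv]; ring)
    apply fin
    left
    have : b = 0 := by omega
    simp [this]
  · have hc : IsCoprime (a ^ 2) (4 * (a ^ 2 - 1)) := by
      obtain ⟨t, rfl⟩ := ho
      have h2 : IsCoprime (2 * t + 1) (2 : ℤ) := ⟨1, -t, by ring⟩
      have h4 : IsCoprime ((2 * t + 1) ^ 2) (2 ^ 2 : ℤ) := h2.pow
      exact IsCoprime.mul_right (by simpa using h4) ⟨1, -1, by ring⟩
    obtain ⟨⟨k, hk⟩, ⟨l, hl⟩⟩ := Int.eq_pow_of_mul_eq_pow_odd hc hn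
      (show a ^ 2 * (4 * (a ^ 2 - 1)) = c ^ n by rw [← key]; ring)
    obtain ⟨j, hj⟩ : ∃ j, a = j ^ n := by
      obtain ⟨m, rfl⟩ := hn
      have ha0 : a ≠ 0 := by rintro rfl; exact absurd ho (by decide)
      have hk0 : k ≠ 0 := by
        rintro rfl
        rw [zero_pow hn0] at hk
        exact ha0 (pow_eq_zero_iff two_ne_zero |>.mp hk)
      have : (k ^ m) ^ 2 ∣ a ^ 2 := ⟨k, by rw [hk]; ring⟩
      obtain ⟨j, hj⟩ := (Int.pow_dvd_pow_iff two_ne_zero).mp this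
      refine ⟨j, ?_⟩
      have hjk : j ^ 2 = k := by
        have : (k ^ m) ^ 2 * j ^ 2 = (k ^ m) ^ 2 * k := by
          rw [← mul_pow, ← hj, hk]; ring
        exact mul_left_cancel₀ (by positivity) this
      rw [pow_succ, pow_mul, hjk, hj]
    have hle : Even (l ^ n) := by rw [← hl]; exact ⟨2 * (a ^ 2 - 1), by ring⟩
    obtain ⟨q, hq, m, rfl⟩ := Nat.exists_prime_and_dvd (n := n) (by omega)
    have hqo : Odd q := (Nat.odd_mul.mp hn).1
    have hm0 : m ≠ 0 := by rintro rfl; simp at hn0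
    have hl2 : Even (l ^ m) := ((Int.even_pow.mp hle).1).pow_of_ne_zero hm0
    obtain ⟨z, hz⟩ := hl2.two_dvd
    have hjo : Odd (j ^ m) := by
      rw [hj] at ho
      by_contra h
      rw [Int.not_odd_iff_even] at h
      rw [← Int.not_even_iff_odd, mul_comm, pow_mul] at ho
      exact ho (h.pow_of_ne_zero hq.ne_zero)
    have := special (j ^ m) z q hq hqo hjo (by
      rw [← hz, ← pow_mul l, mul_comm m q, ← hl, hj]; ring)
    apply fin
    right
    rw [this, mul_zero] at hz
    have : l ^ (q * m) = 0 := by rw [mul_comm, pow_mul, hz, zero_pow hq.ne_zero]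
    rw [this] at hl
    omega
lemma gauss_unit (u : GaussianInt) (hu : IsUnit u) : u ^ 4 = 1 := by
  have h := (Zsqrtd.norm_eq_one_iff' (by norm_num) u).mpr hu
  obtain ⟨a, b⟩ := u
  rw [Zsqrtd.norm_def] at h
  simp only at h
  have h' : a * a + b * b = 1 := by linarith
  have ha : -1 ≤ a ∧ a ≤ 1 := by constructor <;> nlinarith [mul_self_nonneg b]
  have hb : -1 ≤ b ∧ b ≤ 1 := by constructor <;> nlinarith [mul_self_nonneg a]
  obtain ⟨ha1, ha2⟩ := ha
  obtain ⟨hb1, hb2⟩ := hb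
  interval_cases a <;> interval_cases b <;> first | (exfalso; omega) | decide

lemma lebesgue (x y : ℤ) (p : ℕ) (hpp : p.Prime) (hp : Odd p) (h : y ^ p = 1 + x ^ 2) : x = 0 := by
  have hp2 := hpp.two_le
  have hxe : Even x := by
    by_contra hx
    obtain ⟨r, rfl⟩ := Int.not_even_iff_odd.mp hx
    have hy : Even y := by
      have : Even (y ^ p) := by rw [h]; exact ⟨2 * r ^ 2 + 2 * r + 1, by ring⟩
      exact (Int.even_pow.mp this).1
    obtain ⟨z, rfl⟩ := hy.two_dvd
    have h4 : (4 : ℤ) ∣ (2 * z) ^ p := by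
      have h1 : (2 * z) ^ 2 ∣ (2 * z) ^ p := pow_dvd_pow _ hp2
      exact dvd_trans ⟨z ^ 2, by ring⟩ h1
    rw [h] at h4
    obtain ⟨w, hw⟩ := h4
    have : 4 * (r ^ 2 + r) + 2 = 4 * w := by linarith
    omega
  obtain ⟨t, rfl⟩ := hxe.two_dvd
  have hmul : (⟨1, 2 * t⟩ : GaussianInt) * ⟨1, -(2 * t)⟩ = ((y : ℤ) : GaussianInt) ^ p := by
    rw [← Int.cast_pow, h]
    ext
    · simp only [Zsqrtd.re_mul, Zsqrtd.re_intCast]; ring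
    · simp only [Zsqrtd.im_mul, Zsqrtd.im_intCast]; ring
  have hsum : (⟨1, 2 * t⟩ : GaussianInt) + ⟨1, -(2 * t)⟩ = 2 := by
    ext <;> simp
  have hcop : IsCoprime (⟨1, 2 * t⟩ : GaussianInt) ⟨1, -(2 * t)⟩ := by
    refine ⟨⟨1, -(2 * t)⟩ - 2 * ((t ^ 2 : ℤ) : GaussianInt), - 2 * ((t ^ 2 : ℤ) : GaussianInt), ?_⟩
    have h1 : ((y : ℤ) : GaussianInt) ^ p = 1 + 4 * ((t ^ 2 : ℤ) : GaussianInt) := by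
      rw [← Int.cast_pow, h]; push_cast; ring
    linear_combination hmul - 2 * ((t ^ 2 : ℤ) : GaussianInt) * hsum + h1
  obtain ⟨w0, u, hu⟩ := exists_associated_pow_of_mul_eq_pow' hcop hmul
  have hu4 := gauss_unit u u.isUnit
  obtain ⟨w, hw⟩ : ∃ w : GaussianInt, w ^ p = ⟨1, 2 * t⟩ := by
    refine ⟨w0 * (u : GaussianInt) ^ p, ?_⟩
    rw [mul_pow, ← hu]
    congr 1
    obtain ⟨r, rfl⟩ := hp
    rw [← pow_mul, show (2 * r + 1) * (2 * r + 1) = 4 * (r ^ 2 + r) + 1 by ring, pow_succ, pow_mul,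
      hu4]
    simp
  have hT : w + star w = ((2 * w.re : ℤ) : GaussianInt) := by
    ext
    · simp; ring
    · simp
  have hN : w * star w = ((w.norm : ℤ) : GaussianInt) := (Zsqrtd.norm_eq_mul_conj w).symm
  have hV := (lucV_eq w (star w) _ _ hT hN p).1
  rw [← star_pow, hw] at hV
  have hV2 : lucV (2 * w.re) w.norm p = 2 := by
    have := congrArg Zsqrtd.re hV
    simp at this
    linarith
  have hNp : w.norm ^ p = 1 + (2 * t) ^ 2 := by
    have h1 := congrArg Zsqrtd.norm hw
    rw [Zsqrtd.norm_def ⟨1, 2 * t⟩] at h1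
    have h2 : (w ^ p).norm = w.norm ^ p := map_pow Zsqrtd.normMonoidHom w p
    rw [← h2, h1]; simp only; ring
  have := core _ _ _ p hpp hp hV2 hNp (fun _ => ⟨t ^ 2, by ring⟩)
  exact pow_eq_zero_iff two_ne_zero |>.mp this
universe u

lemma isIntegral_of_minpoly_X_pow {K : Type u} [Field K] {E : Type u} [Field E] [Algebra K E] (x : E)
    (m : ℕ) (hm : 0 < m) (a : K) (hx : minpoly K x = X ^ m - C a) : IsIntegral K x :=
  not_not.mp fun h ↦ by
    simpa only [degree_zero, degree_X_pow_sub_C hm,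
        WithBot.natCast_ne_bot] using congr_arg degree (hx.symm.trans (dif_neg h))

open IntermediateField in
lemma norm_gen_X_pow {K : Type u} [Field K] {E : Type u} [Field E] [Algebra K E] (x : E)
    (m : ℕ) (hm : 0 < m) (hme : Even m) (a : K) (hx : minpoly K x = X ^ m - C a) :
    Algebra.norm K (AdjoinSimple.gen K x) = -a ∧ Algebra.norm K (- AdjoinSimple.gen K x) = -a := by
  have hi := isIntegral_of_minpoly_X_pow x m hm a hx
  have h1 : Algebra.norm K (AdjoinSimple.gen K x) = -a := by
    rw [← adjoin.powerBasis_gen hi, Algebra.PowerBasis.norm_gen_eq_coeff_zero_minpoly]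
    simp [minpoly_gen, hx, hm.ne, hme.neg_pow]
  refine ⟨h1, ?_⟩
  rw [← neg_one_mul, map_mul, h1]
  have : Algebra.norm K (-1 : K⟮x⟯) = 1 := by
    have h2 : (-1 : K⟮x⟯) = algebraMap K K⟮x⟯ (-1) := by simp
    rw [h2, Algebra.norm_algebraMap, adjoin.finrank hi, hx, natDegree_X_pow_sub_C, hme.neg_one_pow]
  rw [this, one_mul]

lemma X_pow_two_pow_irreducible (k : ℕ) : ∀ {K : Type u} [Field K] (a : K) (_ : ∀ b : K, b ^ 2 ≠ a)
    (_ : 1 ≤ k → ∀ b : K, b ^ 2 ≠ -a), Irreducible (X ^ (2 ^ (k + 1)) - C a) := by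
  induction k with
  | zero => intro K _ a h1 _; simpa using X_pow_sub_C_irreducible_of_prime Nat.prime_two h1
  | succ k ih =>
    intro K _ a h1 h2
    rw [pow_succ]
    apply X_pow_mul_sub_C_irreducible (X_pow_sub_C_irreducible_of_prime Nat.prime_two h1)
    intro E _ _ x hx
    have hn := norm_gen_X_pow x 2 (by norm_num) (by decide) a hx
    apply ih
    · intro b hb
      exact h2 (by omega) (Algebra.norm K b) (by rw [← map_pow, hb, hn.1])
    · intro _ b hb
      exact h2 (by omega) (Algebra.norm K b) (by rw [← map_pow, hb, hn.2])

lemma X_pow_irreducible_gen {K : Type u} [Field K] (a : K) (d : ℕ) (hd : d ≠ 0)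
    (h1 : ∀ p : ℕ, p.Prime → p ∣ d → ∀ b : K, b ^ p ≠ a)
    (h2 : 4 ∣ d → ∀ b : K, b ^ 2 ≠ -a) : Irreducible (X ^ d - C a) := by
  obtain ⟨k, m, hm, rfl⟩ := Nat.exists_eq_two_pow_mul_odd hd
  rcases k with _ | k
  · rw [pow_zero, one_mul] at *
    exact X_pow_sub_C_irreducible_of_odd hm h1
  · rw [mul_comm]
    apply X_pow_mul_sub_C_irreducible
    · apply X_pow_two_pow_irreducible
      · exact h1 2 Nat.prime_two ⟨2 ^ k * m, by ring⟩
      · intro hk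
        refine h2 ?_
        obtain ⟨j, rfl⟩ : ∃ j, k = j + 1 := ⟨k - 1, by omega⟩
        exact ⟨2 ^ j * m, by ring⟩
    · intro E _ _ x hx
      have hn := norm_gen_X_pow x (2 ^ (k + 1)) (by positivity) ⟨2 ^ k, by ring⟩ a hx
      apply X_pow_sub_C_irreducible_of_odd hm
      intro p hp hpm b hb
      have hpo : Odd p := hm.of_dvd_nat hpm
      refine h1 p hp (dvd_mul_of_dvd_right hpm _) (- Algebra.norm K b) ?_
      rw [hpo.neg_pow, ← map_pow, hb, hn.1, neg_neg]

lemma norm_sub_gen {L K : Type*} [Field L] [Field K] [Algebra L K] (pb : PowerBasis L K)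
    (e : ℕ) (γ t : L) (h : minpoly L pb.gen = X ^ e - C γ) :
    Algebra.norm L (algebraMap L K t - pb.gen) = t ^ e - γ := by
  have h1 := charpoly_leftMulMatrix pb
  rw [h] at h1
  have h2 := congrArg (eval t) h1
  rw [Matrix.eval_charpoly] at h2
  rw [Algebra.norm_eq_matrix_det pb.basis, map_sub, AlgHom.commutes]
  simp at h2
  exact h2
lemma quad_conj_pow {L : Type*} [Field L] [Algebra ℚ L] (θ : L) (c : ℤ) (hθ : θ ^ 2 = -(c : L)) (a b : ℚ)
    (k : ℕ) : ∃ A B : ℚ,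
      (algebraMap ℚ L a + algebraMap ℚ L b * θ) ^ k = algebraMap ℚ L A + algebraMap ℚ L B * θ ∧
      (algebraMap ℚ L a - algebraMap ℚ L b * θ) ^ k = algebraMap ℚ L A - algebraMap ℚ L B * θ := by
  induction k with
  | zero => exact ⟨1, 0, by simp, by simp⟩
  | succ k ih =>
    obtain ⟨A, B, h1, h2⟩ := ih
    refine ⟨A * a - B * b * c, A * b + B * a, ?_, ?_⟩
    · rw [pow_succ, h1]
      simp only [map_sub, map_add, map_mul, map_intCast]
      linear_combination algebraMap ℚ L B * algebraMap ℚ L b * hθ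
    · rw [pow_succ, h2]
      simp only [map_sub, map_add, map_mul, map_intCast]
      linear_combination algebraMap ℚ L B * algebraMap ℚ L b * hθ

lemma rat_int_of_integral {L : Type*} [Field L] [Algebra ℚ L] (r : ℚ)
    (h : IsIntegral ℤ (algebraMap ℚ L r)) : ∃ n : ℤ, (n : ℚ) = r := by
  have h1 : IsIntegral ℤ r :=
    (isIntegral_algebraMap_iff (algebraMap ℚ L).injective).mp h
  obtain ⟨n, hn⟩ := IsIntegrallyClosed.isIntegral_iff.mp h1
  exact ⟨n, by simpa using hn⟩

lemma quad_core {L : Type*} [Field L] [Algebra ℚ L] (θ : L) (c : ℤ) (hθ : θ ^ 2 = -(c : L))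
    (hirr : ∀ r : ℚ, algebraMap ℚ L r ≠ θ)
    (hspan : ∀ x : L, ∃ a b : ℚ, x = algebraMap ℚ L a + algebraMap ℚ L b * θ)
    (x : L) (p j : ℕ) (hp : 0 < p) (hx : x ^ p = 1 + θ ^ (2 * j + 1)) :
    ∃ T N : ℤ, lucV T N p = 2 ∧ N ^ p = 1 + c ^ (2 * j + 1) := by
  have : CharZero L := algebraRat.charZero L
  obtain ⟨a, b, rfl⟩ := hspan x
  obtain ⟨A, B, h1, h2⟩ := quad_conj_pow θ c hθ a b p
  have hθn : θ ^ (2 * j + 1) = algebraMap ℚ L ((-c) ^ j) * θ := by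
    rw [pow_succ, pow_mul, hθ]; simp
  rw [h1, hθn] at hx
  have hB : B = (-c) ^ j := by
    by_contra hne
    have hne' : B - (-c) ^ j ≠ 0 := sub_ne_zero.mpr hne
    apply hirr ((1 - A) / (B - (-c) ^ j))
    have h3 : algebraMap ℚ L (B - (-c) ^ j) ≠ 0 :=
      (map_ne_zero (algebraMap ℚ L)).mpr hne'
    rw [map_div₀, div_eq_iff h3, map_sub, map_sub, map_one]
    linear_combination -hx
  have hA : A = 1 := by
    rw [hB] at hx
    have : algebraMap ℚ L A = algebraMap ℚ L 1 := by rw [map_one]; linear_combination hx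
    exact (algebraMap ℚ L).injective this
  set x := algebraMap ℚ L a + algebraMap ℚ L b * θ with hxd
  set y := algebraMap ℚ L a - algebraMap ℚ L b * θ with hyd
  have hθi : IsIntegral ℤ θ := by
    apply IsIntegral.of_pow (n := 2) (by norm_num)
    rw [hθ]
    have : (-(c : L)) = algebraMap ℤ L (-c) := by simp
    rw [this]; exact isIntegral_algebraMap
  have hBi : IsIntegral ℤ (algebraMap ℚ L B * θ) := by
    refine IsIntegral.mul ?_ hθi
    have : algebraMap ℚ L B = algebraMap ℤ L ((-c) ^ j) := by rw [hB]; simp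
    rw [this]; exact isIntegral_algebraMap
  have hxi : IsIntegral ℤ x := by
    apply IsIntegral.of_pow hp
    rw [h1, hA, map_one]
    exact isIntegral_one.add hBi
  have hyi : IsIntegral ℤ y := by
    apply IsIntegral.of_pow hp
    rw [h2, hA, map_one]
    exact isIntegral_one.sub hBi
  have hxy : x + y = algebraMap ℚ L (2 * a) := by
    rw [hxd, hyd, map_mul, map_ofNat]; ring
  have hxy2 : x * y = algebraMap ℚ L (a ^ 2 + b ^ 2 * c) := by
    rw [hxd, hyd]
    simp only [map_add, map_mul, map_pow, map_intCast]
    linear_combination -(algebraMap ℚ L b) ^ 2 * hθ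
  obtain ⟨T, hT⟩ := rat_int_of_integral (L := L) (2 * a) (hxy ▸ hxi.add hyi)
  obtain ⟨N, hN⟩ := rat_int_of_integral (L := L) (a ^ 2 + b ^ 2 * c) (hxy2 ▸ hxi.mul hyi)
  have hxy' : x + y = (T : L) := by rw [hxy, ← hT]; simp
  have hxy2' : x * y = (N : L) := by rw [hxy2, ← hN]; simp
  refine ⟨T, N, ?_, ?_⟩
  · have h := (lucV_eq x y T N hxy' hxy2' p).1
    rw [h1, h2, hA, map_one] at h
    have : ((lucV T N p : ℤ) : L) = ((2 : ℤ) : L) := by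
      rw [← h]; push_cast; ring
    exact_mod_cast this
  · have h : (N : L) ^ p = 1 + (c : L) ^ (2 * j + 1) := by
      rw [← hxy2', mul_pow, h1, h2, hA, hB]
      simp only [map_one, map_pow, map_neg, map_intCast]
      have h3 : ((-(c : L)) ^ j) ^ 2 = (c : L) ^ (2 * j) := by
        rw [← pow_mul, mul_comm, pow_mul, neg_sq, ← pow_mul]
      rw [pow_succ, ← h3]
      linear_combination - ((-(c : L)) ^ j) ^ 2 * hθ
    exact_mod_cast h

open IntermediateField in
lemma even_setup {F K : Type} [Field F] [CharZero F] [Field K] [Algebra F K] (j : ℕ) (c : F) (hc : c ≠ 0)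
    (pb : PowerBasis F K) (hmin : minpoly F pb.gen = X ^ (2 * (j + 1)) + C (1 / c)) :
    ∃ (L : Type) (_ : Field L) (_ : Algebra F L) (N : K →* L) (θ : L), θ ^ 2 = -algebraMap F L c ∧
      (∀ r : F, algebraMap F L r ≠ θ) ∧
      (∀ x : L, ∃ a b : F, x = algebraMap F L a + algebraMap F L b * θ) ∧
      N (algebraMap F K (1 / c) - pb.gen) * θ ^ (2 * (j + 1)) =
        (-1) ^ (j + 1) * (1 + θ ^ (2 * j + 1)) ∧ N (-1) = (-1) ^ (j + 1) := by
  set α := pb.gen with hα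
  have hfd : FiniteDimensional F K := pb.finite
  have : CharZero K := charZero_of_injective_algebraMap (algebraMap F K).injective
  have hcK : algebraMap F K c ≠ 0 := by simpa using hc
  have hαd : α ^ (2 * (j + 1)) = -(1 / algebraMap F K c) := by
    have h := minpoly.aeval F α
    rw [hmin] at h
    simp at h
    rw [eq_neg_iff_add_eq_zero]
    simpa using h
  have hrank : Module.finrank F K = 2 * (j + 1) := by
    rw [pb.finrank, ← pb.natDegree_minpoly, ← hα, hmin, natDegree_X_pow_add_C]
  have htop : F⟮α⟯ = ⊤ := by
    rw [Field.primitive_element_iff_minpoly_natDegree_eq, hmin, hrank, natDegree_X_pow_add_C]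
  set g : K := α ^ (j + 1) with hg
  have hg2 : g ^ 2 = -(1 / algebraMap F K c) := by rw [hg, ← pow_mul, mul_comm, hαd]
  have hgi : IsIntegral F g := IsIntegral.of_finite F g
  let L := F⟮g⟯
  let γ : L := AdjoinSimple.gen F g
  have hγg : algebraMap L K γ = g := AdjoinSimple.algebraMap_gen F g
  have htopL : L⟮α⟯ = ⊤ := adjoin_eq_top_of_adjoin_eq_top F htop
  have hαL : IsIntegral L α := IsIntegral.of_finite L α
  have hdegL : Module.finrank F L ≤ 2 := by
    rw [adjoin.finrank hgi]
    have hdvd : minpoly F g ∣ X ^ 2 + C (1 / c) := by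
      apply minpoly.dvd
      simp [hg2]
    have := natDegree_le_of_dvd hdvd (X_pow_add_C_ne_zero (by norm_num) _)
    rwa [natDegree_X_pow_add_C] at this
  have hdvdα : minpoly L α ∣ X ^ (j + 1) - C γ := by
    apply minpoly.dvd
    simp only [map_sub, map_pow, aeval_X, aeval_C]
    rw [hγg, hg, sub_self]
  have hKL : Module.finrank L K = (minpoly L α).natDegree :=
    ((Field.primitive_element_iff_minpoly_natDegree_eq L α).mp htopL).symm
  have hdegK : Module.finrank L K ≤ j + 1 := by
    rw [hKL]
    have := natDegree_le_of_dvd hdvdα (X_pow_sub_C_ne_zero (by omega) _)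
    rwa [natDegree_X_pow_sub_C] at this
  have hmul := Module.finrank_mul_finrank F L K
  rw [hrank] at hmul
  have hL2 : Module.finrank F L = 2 := by nlinarith
  have hK2 : Module.finrank L K = j + 1 := by nlinarith
  have hminL : minpoly L α = X ^ (j + 1) - C γ := by
    symm
    refine eq_of_monic_of_dvd_of_natDegree_le (minpoly.monic hαL) (monic_X_pow_sub_C _ (by omega))
      hdvdα ?_
    rw [natDegree_X_pow_sub_C, ← hKL, hK2]
  have hadj : Algebra.adjoin L {α} = ⊤ := by
    rw [← adjoin_simple_toSubalgebra_of_isAlgebraic hαL.isAlgebraic, htopL]; rfl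
  let pbL : PowerBasis L K := PowerBasis.ofAdjoinEqTop hαL hadj
  have hnorm := norm_sub_gen pbL (j + 1) γ (algebraMap F L (1 / c)) hminL
  have hpbL : pbL.gen = α := rfl
  rw [hpbL, ← IsScalarTower.algebraMap_apply] at hnorm
  have : CharZero L := charZero_of_injective_algebraMap (algebraMap F L).injective
  have hcL : algebraMap F L c ≠ 0 := by simpa using hc
  have hγ2 : γ ^ 2 = -(1 / algebraMap F L c) := by
    apply (algebraMap L K).injective
    rw [map_pow, hγg, hg2]
    simp
  have hγ0 : γ ≠ 0 := by
    intro h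
    rw [h] at hγ2
    field_simp at hγ2
    simp at hγ2
  have hspan : ∀ x : L, ∃ a b : F, x = algebraMap F L a + algebraMap F L b * γ := by
    intro x
    obtain ⟨f, hf, hfx⟩ := (adjoin.powerBasis hgi).exists_eq_aeval x
    rw [← PowerBasis.finrank, hL2] at hf
    rw [adjoin.powerBasis_gen] at hfx
    refine ⟨f.coeff 0, f.coeff 1, ?_⟩
    rw [hfx, eq_X_add_C_of_natDegree_le_one (by omega : f.natDegree ≤ 1)]
    simp
    ring
  have hirr : ∀ r : F, algebraMap F L r ≠ γ := by
    intro r hr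
    have : Module.finrank F L = 1 := by
      have hbot : L = ⊥ := by
        rw [adjoin_simple_eq_bot_iff, mem_bot]
        refine ⟨r, ?_⟩
        rw [← hγg, ← hr, ← IsScalarTower.algebraMap_apply]
      rw [hbot]
      exact IntermediateField.finrank_bot
    omega
  set σ : L := -(-1) ^ (j + 1) with hσ
  have hσ2 : σ ^ 2 = 1 := by rw [hσ, neg_sq, ← pow_mul, mul_comm, pow_mul]; simp
  have hσq : ∃ s : F, algebraMap F L s = σ ∧ s ^ 2 = 1 := by
    refine ⟨-(-1) ^ (j + 1), by simp [hσ], by rw [neg_sq, ← pow_mul, mul_comm, pow_mul]; simp⟩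
  obtain ⟨s, hs, hs2⟩ := hσq
  have hs0 : s ≠ 0 := by rintro rfl; norm_num at hs2
  have hγθ : γ = algebraMap F L (-s / c) * (σ * γ⁻¹) := by
    have h2 : γ * γ = -(1 / algebraMap F L c) := by rw [← sq, hγ2]
    rw [map_div₀, map_neg, hs]
    field_simp
    field_simp at h2
    linear_combination h2 + hσ2
  refine ⟨L, inferInstance, inferInstance, Algebra.norm L, σ * γ⁻¹, ?_, ?_, ?_, ?_, ?_⟩
  · rw [mul_pow, hσ2, inv_pow, hγ2]; simp
  · intro r hr
    apply hirr (-s / c * r)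
    rw [map_mul, hr, ← hγθ]
  · intro x
    obtain ⟨a, b, h⟩ := hspan x
    refine ⟨a, b * (-s / c), ?_⟩
    rw [map_mul, mul_assoc, ← hγθ]; exact h
  · rw [hnorm]
    have ht : algebraMap F L (1 / c) = -γ ^ 2 := by rw [hγ2]; simp
    have g1 : (γ ^ 2) ^ (j + 1) * (γ⁻¹) ^ (2 * (j + 1)) = 1 := by
      rw [← pow_mul, ← mul_pow, mul_inv_cancel₀ hγ0, one_pow]
    have g2 : γ * (γ⁻¹) ^ (2 * (j + 1)) = (γ⁻¹) ^ (2 * j + 1) := by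
      rw [show 2 * (j + 1) = 2 * j + 1 + 1 by ring, pow_succ', ← mul_assoc,
        mul_inv_cancel₀ hγ0, one_mul]
    have g3 : (-1 : L) ^ (j + 1) * σ = -1 := by
      have h5 : ((-1 : L) ^ (j + 1)) ^ 2 = 1 := by rw [← pow_mul, mul_comm, pow_mul]; simp
      rw [hσ]; linear_combination -h5
    have g4 : (σ * γ⁻¹) ^ (2 * (j + 1)) = (γ⁻¹) ^ (2 * (j + 1)) := by
      rw [mul_pow, pow_mul σ, hσ2, one_pow, one_mul]
    have g5 : (σ * γ⁻¹) ^ (2 * j + 1) = σ * (γ⁻¹) ^ (2 * j + 1) := by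
      rw [mul_pow, pow_succ σ, pow_mul σ, hσ2, one_pow, one_mul]
    rw [ht, g4, g5, neg_pow (γ ^ 2)]
    linear_combination (-1 : L) ^ (j + 1) * g1 - g2 - (γ⁻¹) ^ (2 * j + 1) * g3
  · have h2 : (-1 : K) = algebraMap L K (-1) := by simp
    rw [h2, Algebra.norm_algebraMap, hK2]

lemma even_no_odd_root {K : Type} [Field K] [Algebra ℚ K] (j : ℕ) (hj : 1 ≤ j) (c : ℤ) (hc : c ≠ 0)
    (pb : PowerBasis ℚ K) (hmin : minpoly ℚ pb.gen = X ^ (2 * (j + 1)) + C (1 / (c : ℚ)))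
    (p : ℕ) (hpp : p.Prime) (hp : Odd p) (hpd : p ∣ 2 * (j + 1)) (b : K) :
    b ^ p ≠ pb.gen - algebraMap ℚ K (1 / (c : ℚ)) := by
  intro hb
  obtain ⟨L, iL, iA, N, θ, hθ, hirr, hspan, hN, hN1⟩ :=
    even_setup j (c : ℚ) (by exact_mod_cast hc) pb hmin
  rw [map_intCast] at hθ
  obtain ⟨k, hk⟩ := hpd
  have hb' : (-b) ^ p = algebraMap ℚ K (1 / (c : ℚ)) - pb.gen := by
    rw [hp.neg_pow, hb]; ring
  have hx : ((-1) ^ (j + 1) * N (-b) * θ ^ k) ^ p = 1 + θ ^ (2 * j + 1) := by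
    have h1 : ((-1 : L) ^ (j + 1)) ^ p = (-1) ^ (j + 1) := by
      rw [← pow_mul, mul_comm, pow_mul, hp.neg_one_pow]
    have h2 : ((-1 : L) ^ (j + 1)) ^ 2 = 1 := by rw [← pow_mul, mul_comm, pow_mul]; simp
    rw [mul_pow, mul_pow, ← map_pow, hb', ← pow_mul θ k p, mul_comm k p, ← hk, h1, mul_assoc, hN]
    linear_combination (1 + θ ^ (2 * j + 1)) * h2
  obtain ⟨T, M, hV, hM⟩ := quad_core θ c hθ hirr hspan _ p j hpp.pos hx
  have := core T M (c ^ (2 * j + 1)) p hpp hp hV hM (by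
    intro h
    have h2 : (2 : ℤ) ∣ c := Int.prime_two.dvd_of_dvd_pow h
    have h4 : (2 : ℤ) ^ 2 ∣ c ^ 2 := pow_dvd_pow_of_dvd h2 2
    have h5 : c ^ 2 ∣ c ^ (2 * j + 1) := pow_dvd_pow c (by omega)
    exact (by norm_num : (4 : ℤ) = 2 ^ 2) ▸ h4.trans h5)
  exact hc (pow_eq_zero_iff (by omega) |>.mp this)

lemma even_no_sq_root {K : Type} [Field K] [Algebra ℚ K] (j : ℕ) (hj : 1 ≤ j) (c : ℤ) (hc : c ≠ 0)
    (pb : PowerBasis ℚ K) (hmin : minpoly ℚ pb.gen = X ^ (2 * (j + 1)) + C (1 / (c : ℚ))) (b : K)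
    (hb : b ^ 2 = pb.gen - algebraMap ℚ K (1 / (c : ℚ)) ∨
      (Even (j + 1) ∧ b ^ 2 = algebraMap ℚ K (1 / (c : ℚ)) - pb.gen)) : False := by
  obtain ⟨L, iL, iA, N, θ, hθ, hirr, hspan, hN, hN1⟩ :=
    even_setup j (c : ℚ) (by exact_mod_cast hc) pb hmin
  rw [map_intCast] at hθ
  have h2 : ((-1 : L) ^ (j + 1)) ^ 2 = 1 := by rw [← pow_mul, mul_comm, pow_mul]; simp
  have hx : (N b * θ ^ (j + 1)) ^ 2 = 1 + θ ^ (2 * j + 1) := by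
    rw [mul_pow, ← map_pow, ← pow_mul, mul_comm (j + 1) 2]
    rcases hb with hb | ⟨he, hb⟩
    · have : b ^ 2 = (-1) * (algebraMap ℚ K (1 / (c : ℚ)) - pb.gen) := by rw [hb]; ring
      rw [this, map_mul, hN1, mul_assoc, hN]
      linear_combination (1 + θ ^ (2 * j + 1)) * h2
    · rw [hb, hN, he.neg_one_pow, one_mul]
  obtain ⟨T, M, hV, hM⟩ := quad_core θ c hθ hirr hspan _ 2 j (by norm_num) hx
  refine hc (square_case T M c (2 * j + 1) ⟨j, rfl⟩ (by omega) ?_ hM)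
  simp [lucV] at hV
  linear_combination hV

lemma odd_no_root {K : Type} [Field K] [Algebra ℚ K] (m : ℕ) (c : ℤ) (hc : c ≠ 0)
    (pb : PowerBasis ℚ K) (hmin : minpoly ℚ pb.gen = X ^ (2 * m + 1) + C (1 / (c : ℚ)))
    (p : ℕ) (hpp : p.Prime) (hp : Odd p) (hpd : p ∣ 2 * m + 1) (b : K) :
    b ^ p ≠ pb.gen - algebraMap ℚ K (1 / (c : ℚ)) := by
  intro hb
  have hcq : (c : ℚ) ≠ 0 := by exact_mod_cast hc
  obtain ⟨k, hk⟩ := hpd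
  have hb' : (-b) ^ p = algebraMap ℚ K (1 / (c : ℚ)) - pb.gen := by
    rw [hp.neg_pow, hb]; ring
  have hnorm := norm_sub_gen pb (2 * m + 1) (-(1 / (c : ℚ))) (1 / (c : ℚ))
    (by rw [hmin, C_neg, sub_neg_eq_add])
  rw [← hb', map_pow] at hnorm
  have hx : ((c : ℚ) ^ k * Algebra.norm ℚ (-b)) ^ p = ((1 + (c ^ m) ^ 2 : ℤ) : ℚ) := by
    rw [mul_pow, hnorm, ← pow_mul, mul_comm k p, ← hk]
    push_cast
    rw [one_div, inv_pow]
    field_simp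
    ring
  have hyint : IsIntegral ℤ ((c : ℚ) ^ k * Algebra.norm ℚ (-b)) := by
    apply IsIntegral.of_pow hpp.pos
    rw [hx]
    exact isIntegral_algebraMap (R := ℤ) (A := ℚ) (x := 1 + (c ^ m) ^ 2)
  obtain ⟨y, hy⟩ := IsIntegrallyClosed.isIntegral_iff.mp hyint
  rw [← hy] at hx
  have hy2 : y ^ p = 1 + (c ^ m) ^ 2 := by
    have : ((y ^ p : ℤ) : ℚ) = ((1 + (c ^ m) ^ 2 : ℤ) : ℚ) := by rw [← hx]; simp
    exact_mod_cast this
  have := lebesgue _ _ p hpp hp hy2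
  exact pow_ne_zero m hc this

lemma main_irred {K : Type} [Field K] [Algebra ℚ K] (d : ℕ) (hd : 3 ≤ d) (c : ℤ) (hc : c ≠ 0)
    (pb : PowerBasis ℚ K) (hmin : minpoly ℚ pb.gen = X ^ d + C (1 / (c : ℚ))) :
    Irreducible (X ^ d - C (pb.gen - algebraMap ℚ K (1 / (c : ℚ)))) := by
  apply X_pow_irreducible_gen _ d (by omega)
  · intro p hpp hpd b
    rcases Nat.even_or_odd' d with ⟨m, rfl | rfl⟩
    · obtain ⟨j, rfl⟩ : ∃ j, m = j + 1 := ⟨m - 1, by omega⟩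
      rcases hpp.eq_two_or_odd' with rfl | hp
      · intro hb
        exact even_no_sq_root j (by omega) c hc pb hmin b (Or.inl hb)
      · exact even_no_odd_root j (by omega) c hc pb hmin p hpp hp hpd b
    · have hp : Odd p := Odd.of_dvd_nat ⟨m, rfl⟩ hpd
      exact odd_no_root m c hc pb hmin p hpp hp hpd b
  · rintro ⟨k, rfl⟩ b hb
    obtain ⟨j, hj⟩ : ∃ j, 2 * k = j + 1 := ⟨2 * k - 1, by omega⟩
    have e : 4 * k = 2 * (j + 1) := by omega
    rw [e] at hmin
    refine even_no_sq_root j (by omega) c hc pb hmin b (Or.inr ⟨?_, ?_⟩)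
    · rw [← hj]; exact even_two_mul k
    · rw [hb]; ring

lemma comp_abs {F : Type} [Field F] (d : ℕ) (hd : d ≠ 0) (t : F)
    (f : F[X]) (hf : f = X ^ d + C t) (hirr : Irreducible f)
    (H : ∀ (K : Type) [Field K] [Algebra F K] (pb : PowerBasis F K),
      minpoly F pb.gen = X ^ d + C t → Irreducible (X ^ d - C (pb.gen - algebraMap F K t))) :
    Irreducible (f.comp f) := by
  have hfm : f.Monic := by rw [hf]; exact monic_X_pow_add_C _ hd
  refine Polynomial.irreducible_comp hfm hfm hirr ?_
  intro E _ _ x hx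
  have hxi : IsIntegral F x := by
    by_contra h
    rw [minpoly.eq_zero h] at hx
    exact hirr.ne_zero hx.symm
  have hmin : minpoly F (IntermediateField.adjoin.powerBasis hxi).gen = X ^ d + C t := by
    rw [IntermediateField.adjoin.powerBasis_gen, IntermediateField.minpoly_gen, hx, hf]
  have h := H _ (IntermediateField.adjoin.powerBasis hxi) hmin
  rw [IntermediateField.adjoin.powerBasis_gen] at h
  convert h using 1
  rw [hf, Polynomial.map_add, Polynomial.map_pow, map_X, map_C, C_sub]
  ring

/-- Let `d ≥ 3`, `c` a nonzero integer, and `f(z) = z^d + 1/c ∈ ℚ[z]`. If `f` is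
irreducible over `ℚ`, then `f² = f ∘ f` is irreducible over `ℚ`. -/
theorem stmt19 (d : ℕ) (hd : 3 ≤ d) (c : ℤ) (hc : c ≠ 0)
    (f : ℚ[X]) (hf : f = X ^ d + C (1 / (c : ℚ))) (hirr : Irreducible f) :
    Irreducible (f.comp f) := by
  exact comp_abs d (by omega) _ f hf hirr fun K _ _ pb hmin => main_irred d hd c hc pb hmin
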